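/- arXiv:1809.03654 — 3 statements merged into one kernel-verified Lean document; each statement's English description precedes it below -/
import Mathlib

section
/- Let T > 0, K ≥ 0, δ ∈ (0,1], and let (X, d₀) be a metric space. Let φ : X × [0,T) → ℝ be such that φ(p, 0) = 0 for every p ∈ X and, for each p ∈ X, the function t ↦ φ(p, t) is differentiable on [0,T). Define Φ(p, t) = (T − t)·(∂φ/∂t)(p, t) + φ(p, t). If |Φ(p, t) − Φ(q, t)| ≤ K·d₀(p, q)^δ for all p, q ∈ X and all t ∈ [0,T), then |φ(p, t) − φ(q, t)| ≤ K·(t/T)·d₀(p, q)^δ for all p, q ∈ X and all t ∈ [0,T); in particular |φ(p, t) − φ(q, t)| ≤ K·d₀(p, q)^δ. -/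
open Set Filter

/-- If `u 0 = 0` and `|(T - t) u'(t) + u(t)| ≤ C` on `[0, T)`, then `|u(t)| ≤ C t / T` there:
the left-hand side is `(T - t)²` times the derivative of `u(t) / (T - t)`. -/
theorem abs_le_mul_div_of_abs_sub_mul_deriv_add_le {T C : ℝ} (hT : 0 < T) {u u' : ℝ → ℝ}
    (hu0 : u 0 = 0)
    (hu : ∀ t ∈ Set.Ico (0:ℝ) T, HasDerivWithinAt u (u' t) (Set.Ico (0:ℝ) T) t)
    (hC : ∀ t ∈ Set.Ico (0:ℝ) T, |(T - t) * u' t + u t| ≤ C) :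
    ∀ t ∈ Set.Ico (0:ℝ) T, |u t| ≤ C * (t / T) := by
  intro t ht
  have hden : ∀ s : ℝ, HasDerivAt (fun s => T - s) (-1) s := fun s => by
    simpa using (hasDerivAt_id s).const_sub T
  have hquot : ∀ s ∈ Set.Ico (0:ℝ) T, HasDerivWithinAt (fun s => u s / (T - s))
      (((T - s) * u' s + u s) / (T - s) ^ 2) (Set.Ico (0:ℝ) T) s := fun s hs => by
    refine ((hu s hs).fun_div (hden s).hasDerivWithinAt (sub_pos.2 hs.2).ne').congr_deriv ?_
    ring
  have hbound : ∀ s ∈ Set.Ico (0:ℝ) T,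
      HasDerivAt (fun s => C * (s / T / (T - s))) (C / (T - s) ^ 2) s := fun s hs => by
    have hs' : T - s ≠ 0 := (sub_pos.2 hs.2).ne'
    refine ((((hasDerivAt_id' s).div_const T).fun_div (hden s) hs').const_mul C).congr_deriv ?_
    field_simp
    ring
  have hsub : Set.Icc (0:ℝ) t ⊆ Set.Ico 0 T := Set.Icc_subset_Ico_right ht.2
  have hsub' : Set.Ico (0:ℝ) t ⊆ Set.Ico 0 T := Set.Ico_subset_Icc_self.trans hsub
  have key := image_norm_le_of_norm_deriv_right_le_deriv_boundary'
    (fun s hs => (hquot s (hsub hs)).continuousWithinAt.mono hsub)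
    (fun s hs => (hquot s (hsub' hs)).mono_of_mem_nhdsWithin
      (Filter.mem_of_superset (Ico_mem_nhdsGE (hsub' hs).2)
        (Set.Ico_subset_Ico_left hs.1)))
    (by simp [hu0])
    (fun s hs => (hbound s (hsub hs)).continuousAt.continuousWithinAt)
    (fun s hs => (hbound s (hsub' hs)).hasDerivWithinAt)
    (fun s hs => by
      rw [Real.norm_eq_abs, abs_div, abs_of_nonneg (sq_nonneg (T - s))]
      gcongr
      exact hC s (hsub' hs))
    (Set.right_mem_Icc.2 ht.1)
  have hpos : 0 < T - t := sub_pos.2 ht.2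
  rwa [Real.norm_eq_abs, abs_div, abs_of_pos hpos, ← mul_div_assoc,
    div_le_div_iff_of_pos_right hpos] at key

/-- The integration argument of Corollary 1.1 in abstract form:
if `Φ(p,t) = (T-t)·∂ₜφ(p,t) + φ(p,t)` satisfies a uniform Hölder-type bound
`|Φ(p,t) - Φ(q,t)| ≤ K·d₀(p,q)^δ`, and `φ(·,0) = 0`, then
`|φ(p,t) - φ(q,t)| ≤ K·(t/T)·d₀(p,q)^δ ≤ K·d₀(p,q)^δ`. -/
theorem stmt0 {X : Type*} [MetricSpace X]
    (T K δ : ℝ) (hT : 0 < T) (hK : 0 ≤ K) (hδ : δ ∈ Set.Ioc (0:ℝ) 1)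
    (φ φ' : X → ℝ → ℝ)
    (hφ0 : ∀ p : X, φ p 0 = 0)
    (hderiv : ∀ p : X, ∀ t ∈ Set.Ico (0:ℝ) T,
      HasDerivWithinAt (φ p) (φ' p t) (Set.Ico (0:ℝ) T) t)
    (hΦ : ∀ p q : X, ∀ t ∈ Set.Ico (0:ℝ) T,
      |((T - t) * φ' p t + φ p t) - ((T - t) * φ' q t + φ q t)| ≤ K * dist p q ^ δ) :
    ∀ p q : X, ∀ t ∈ Set.Ico (0:ℝ) T,
      |φ p t - φ q t| ≤ K * (t / T) * dist p q ^ δ ∧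
      |φ p t - φ q t| ≤ K * dist p q ^ δ := by
  intro p q t ht
  have h := abs_le_mul_div_of_abs_sub_mul_deriv_add_le hT
    (u := fun s => φ p s - φ q s) (u' := fun s => φ' p s - φ' q s) (by simp [hφ0])
    (fun s hs => (hderiv p s hs).fun_sub (hderiv q s hs))
    (fun s hs => by
      convert hΦ p q s hs using 2
      ring) t ht
  refine ⟨h.trans_eq (by ring), h.trans ?_⟩
  exact mul_le_of_le_one_right (by positivity) ((div_le_one hT).2 ht.2.le)
end

section
/- Let (X, d₀) be a compact metric space, C > 0, δ ∈ (0,1], and let (dᵢ)_{i∈ℕ} be a sequence of metrics on the set X such that dᵢ(p, q) ≤ C·d₀(p, q)^δ for all i ∈ ℕ and all p, q ∈ X. Then each metric space (X, dᵢ) is compact, and there exist a subsequence (dᵢⱼ) and a compact metric space (Z, d_Z) such that the metric spaces (X, dᵢⱼ) converge to (Z, d_Z) in the Gromov–Hausdorff topology. -/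
open Filter Topology

/-- A family of compact metric spaces, each of which is the image of a fixed compact metric space
under a map satisfying a uniform Hölder estimate, is totally bounded in the Gromov–Hausdorff
space. -/
theorem GromovHausdorff.totallyBounded_of_surjective_of_dist_le_rpow {X : Type*} [MetricSpace X]
    [CompactSpace X] {C δ : ℝ} (hC : 0 < C) (hδ : 0 < δ) {t : Set GromovHausdorff.GHSpace}
    (ht : ∀ p ∈ t, ∃ f : X → p.Rep, Function.Surjective f ∧
      ∀ x y, dist (f x) (f y) ≤ C * dist x y ^ δ) :
    TotallyBounded t := by
  have hnet : ∀ n : ℕ, ∃ s : Finset X, Set.univ ⊆ ⋃ x ∈ s, Metric.ball x (1 / ((n : ℝ) + 1)) := by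
    intro n
    obtain ⟨s, -, hs, hcov⟩ :=
      (isCompact_univ (X := X)).finite_cover_balls (Nat.one_div_pos_of_nat (α := ℝ) (n := n))
    exact ⟨hs.toFinset, by simpa using hcov⟩
  choose s hs using hnet
  refine GromovHausdorff.totallyBounded (C := C * Metric.diam (Set.univ : Set X) ^ δ)
    (u := fun n => C * (1 / ((n : ℝ) + 1)) ^ δ) (K := fun n => (s n).card) ?_ ?_ ?_
  · have h := (tendsto_one_div_add_atTop_nhds_zero_nat (𝕜 := ℝ)).rpow_const
      (p := δ) (Or.inr hδ.le)
    simpa [Real.zero_rpow hδ.ne'] using h.const_mul C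
  · intro p hp
    obtain ⟨f, hf, hfd⟩ := ht p hp
    refine Metric.diam_le_of_forall_dist_le (by positivity) fun a _ b _ => ?_
    obtain ⟨x, rfl⟩ := hf a
    obtain ⟨y, rfl⟩ := hf b
    refine (hfd x y).trans ?_
    gcongr
    exact Metric.dist_le_diam_of_mem isCompact_univ.isBounded (Set.mem_univ x) (Set.mem_univ y)
  · intro p hp n
    obtain ⟨f, hf, hfd⟩ := ht p hp
    refine ⟨f '' (s n : Set X), ?_, ?_⟩
    · simpa using Cardinal.mk_image_le_lift (f := f) (s := (s n : Set X))
    · intro a _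
      obtain ⟨x, rfl⟩ := hf a
      obtain ⟨y, hy, hxy⟩ := Set.mem_iUnion₂.1 (hs n (Set.mem_univ x))
      refine Set.mem_iUnion₂.2 ⟨f y, Set.mem_image_of_mem f hy, ?_⟩
      rw [Metric.mem_ball] at hxy ⊢
      refine (hfd x y).trans_lt ?_
      gcongr

/-- A map satisfying a Hölder estimate with positive exponent is continuous. -/
theorem continuous_of_dist_le_mul_rpow {X Y : Type*} [PseudoMetricSpace X] [PseudoMetricSpace Y]
    {C δ : ℝ} (hδ : 0 < δ) {f : X → Y} (hf : ∀ x y, dist (f x) (f y) ≤ C * dist x y ^ δ) :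
    Continuous f := by
  refine continuous_iff_continuousAt.2 fun y => tendsto_iff_dist_tendsto_zero.2 ?_
  refine squeeze_zero (fun _ => dist_nonneg) (fun x => hf x y) ?_
  have h : Tendsto (fun x => dist x y) (𝓝 y) (𝓝 0) := tendsto_iff_dist_tendsto_zero.1 tendsto_id
  simpa [Real.zero_rpow hδ.ne'] using (h.rpow_const (p := δ) (Or.inr hδ.le)).const_mul C

/-- A compact metric space maps isometrically onto the representative of its class in the
Gromov–Hausdorff space. -/
theorem GromovHausdorff.exists_surjective_dist_eq_rep_toGHSpace (X : Type*) [MetricSpace X]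
    [CompactSpace X] [Nonempty X] :
    ∃ f : X → (GromovHausdorff.toGHSpace X).Rep, Function.Surjective f ∧
      ∀ x y, dist (f x) (f y) = dist x y := by
  obtain ⟨e⟩ := GromovHausdorff.toGHSpace_eq_toGHSpace_iff_isometryEquiv.1
    (GromovHausdorff.GHSpace.toGHSpace_rep (GromovHausdorff.toGHSpace X)).symm
  exact ⟨e, e.surjective, e.dist_eq⟩

/-- Gromov–Hausdorff precompactness for a sequence of metrics on a compact metric space that
are uniformly dominated by a Hölder power of the background distance: each metric space
`(X, dᵢ)` is compact, and some subsequence converges in the Gromov–Hausdorff topology to a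
compact metric space `(Z, d_Z)`. -/
theorem stmt3 {X : Type} (m₀ : MetricSpace X)
    (hcpt : @CompactSpace X m₀.toUniformSpace.toTopologicalSpace) [Nonempty X]
    (C δ : ℝ) (hC : 0 < C) (hδ : δ ∈ Set.Ioc (0:ℝ) 1)
    (m : ℕ → MetricSpace X)
    (hdom : ∀ (i : ℕ) (p q : X), (m i).dist p q ≤ C * m₀.dist p q ^ δ) :
    ∃ hc : ∀ i : ℕ, @CompactSpace X (m i).toUniformSpace.toTopologicalSpace,
      ∃ φ : ℕ → ℕ, StrictMono φ ∧
        ∃ (Z : Type) (mZ : MetricSpace Z) (cZ : @CompactSpace Z mZ.toUniformSpace.toTopologicalSpace)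
          (nZ : Nonempty Z),
          Tendsto
            (fun j => @GromovHausdorff.toGHSpace X (m (φ j)) (hc (φ j)) ‹Nonempty X›)
            atTop (𝓝 (@GromovHausdorff.toGHSpace Z mZ cZ nZ)) := by
  have hc : ∀ i : ℕ, @CompactSpace X (m i).toUniformSpace.toTopologicalSpace := fun i =>
    @Function.Surjective.compactSpace X X m₀.toUniformSpace.toTopologicalSpace
      (m i).toUniformSpace.toTopologicalSpace id
      (@continuous_of_dist_le_mul_rpow X X m₀.toPseudoMetricSpace (m i).toPseudoMetricSpace
        C δ hδ.1 id (hdom i))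
      hcpt Function.surjective_id
  refine ⟨hc, ?_⟩
  let u : ℕ → GromovHausdorff.GHSpace := fun i => @GromovHausdorff.toGHSpace X (m i) (hc i) ‹_›
  have htb : TotallyBounded (Set.range u) := by
    refine GromovHausdorff.totallyBounded_of_surjective_of_dist_le_rpow (X := X) hC hδ.1 ?_
    rintro _ ⟨i, rfl⟩
    obtain ⟨f, hf, hfd⟩ :=
      @GromovHausdorff.exists_surjective_dist_eq_rep_toGHSpace X (m i) (hc i) ‹_›
    exact ⟨f, hf, fun x y => (hfd x y).trans_le (hdom i x y)⟩
  obtain ⟨a, -, φ, hφ, hlim⟩ := htb.closure.isCompact_of_isClosed isClosed_closure |>.tendsto_subseq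
    fun i => subset_closure (Set.mem_range_self (f := u) i)
  refine ⟨φ, hφ, a.Rep, inferInstance, inferInstance, inferInstance, ?_⟩
  rw [GromovHausdorff.GHSpace.toGHSpace_rep]
  exact hlim
end

section
/- Fix integers 1 ≤ k ≤ n and ε > 0, and let π : ℂⁿ → ℂⁿ be the map π(z₁, …, zₙ) = (z₁, z₁z₂, …, z₁z_k, z_{k+1}, …, zₙ) with Hermitian Gram matrix H(z)_{ij} = Σ_{a=1}^{n} (∂π_a/∂z_i)(z) · conj((∂π_a/∂z_j)(z)). For z ∈ ℂⁿ write z' = (z₂, …, z_k) and let F(z) be the n×n Hermitian matrix with F(z)_{ij} = ((1 + ‖z'‖²)·δ_{ij} − conj(z_i)·z_j)/(1 + ‖z'‖²)² when both 2 ≤ i ≤ k and 2 ≤ j ≤ k, and F(z)_{ij} = 0 otherwise. Then for every z ∈ ℂⁿ the Hermitian matrix G(z) = H(z) + ε·F(z) is positive definite. -/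
open scoped ComplexOrder

/-- The local coordinate expression of the blow-down map of the blowup of `ℂⁿ` along the
codimension-`k` subspace `{w₁ = ⋯ = w_k = 0}`:
`π(z₁, …, zₙ) = (z₁, z₁z₂, …, z₁z_k, z_{k+1}, …, zₙ)` (0-indexed here). -/
noncomputable def blowdown (n k : ℕ) [NeZero n] (z : Fin n → ℂ) : Fin n → ℂ :=
  fun a => if (a : ℕ) = 0 then z 0 else if (a : ℕ) < k then z 0 * z a else z a

/-- The complex Jacobian matrix `J(z)_{a i} = ∂π_a/∂z_i` of the blow-down map. -/
noncomputable def blowdownJac (n k : ℕ) [NeZero n] (z : Fin n → ℂ) :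
    Matrix (Fin n) (Fin n) ℂ :=
  Matrix.of fun a i =>
    fderiv ℂ (fun w : Fin n → ℂ => blowdown n k w a) z (Pi.single i 1)

/-- The Hermitian Gram matrix `H(z)_{ij} = Σ_a J(z)_{a i} · conj(J(z)_{a j})`, i.e. the
coefficient matrix of the pullback `π*ω_{ℂⁿ}` of the Euclidean Kähler form. -/
noncomputable def blowdownGram (n k : ℕ) [NeZero n] (z : Fin n → ℂ) :
    Matrix (Fin n) (Fin n) ℂ :=
  Matrix.of fun i j =>
    ∑ a : Fin n, blowdownJac n k z a i * (starRingEnd ℂ) (blowdownJac n k z a j)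

/-- The coefficient matrix `F(z)` of the Fubini–Study form in the variables
`z' = (z₂, …, z_k)` (0-indexed: indices `j` with `1 ≤ j < k`):
`F(z)_{ij} = ((1 + ‖z'‖²)·δ_{ij} − conj(z_i)·z_j)/(1 + ‖z'‖²)²` for `i, j` in that range,
and `0` otherwise. -/
noncomputable def fsBlock (n k : ℕ) (z : Fin n → ℂ) : Matrix (Fin n) (Fin n) ℂ :=
  Matrix.of fun i j =>
    if (1 ≤ (i : ℕ) ∧ (i : ℕ) < k) ∧ (1 ≤ (j : ℕ) ∧ (j : ℕ) < k) then
      (((1 + ∑ l ∈ Finset.univ.filter (fun l : Fin n => 1 ≤ (l : ℕ) ∧ (l : ℕ) < k),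
            Complex.normSq (z l) : ℝ) : ℂ) * (if i = j then 1 else 0)
          - (starRingEnd ℂ) (z i) * z j) /
        (((1 + ∑ l ∈ Finset.univ.filter (fun l : Fin n => 1 ≤ (l : ℕ) ∧ (l : ℕ) < k),
            Complex.normSq (z l) : ℝ) : ℂ) ^ 2)
    else 0

theorem blowdownJac_apply (n k : ℕ) [NeZero n] (z : Fin n → ℂ) (a i : Fin n) :
    blowdownJac n k z a i =
      if (a : ℕ) = 0 then (Pi.single i 1 : Fin n → ℂ) 0
      else if (a : ℕ) < k then
        z 0 * (Pi.single i 1 : Fin n → ℂ) a + z a * (Pi.single i 1 : Fin n → ℂ) 0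
      else (Pi.single i 1 : Fin n → ℂ) a := by
  have hd (b : Fin n) := hasFDerivAt_apply (𝕜 := ℂ) b z
  simp only [blowdownJac, blowdown, Matrix.of_apply]
  split_ifs
  · rw [(hd 0).fderiv]; rfl
  · rw [((hd 0).fun_mul (hd a)).fderiv]; simp
  · rw [(hd a).fderiv]; rfl

theorem blowdownGram_eq (n k : ℕ) [NeZero n] (z : Fin n → ℂ) :
    blowdownGram n k z =
      (blowdownJac n k z).transpose * (blowdownJac n k z).transpose.conjTranspose := by
  ext i j
  simp [blowdownGram, Matrix.mul_apply]

theorem fsBlock_isHermitian (n k : ℕ) (z : Fin n → ℂ) : (fsBlock n k z).IsHermitian := by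
  ext i j
  simp only [fsBlock, Matrix.conjTranspose_apply, Matrix.of_apply]
  by_cases h : (1 ≤ (i : ℕ) ∧ (i : ℕ) < k) ∧ (1 ≤ (j : ℕ) ∧ (j : ℕ) < k)
  · rw [if_pos h, if_pos h.symm]
    simp only [← starRingEnd_apply, map_div₀, map_sub, map_mul, map_pow, Complex.conj_ofReal,
      Complex.conj_conj, apply_ite (starRingEnd ℂ), map_one, map_zero, eq_comm (a := j)]
    ring
  · rw [if_neg h, if_neg fun h' => h h'.symm, star_zero]

/-- The Hermitian form of the Fubini–Study block dominates a multiple of `‖x'‖²`. -/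
theorem le_fsBlock_form (n k : ℕ) (z x : Fin n → ℂ) :
    ∃ c : ℝ, 0 < c ∧
      ((c * ∑ l ∈ Finset.univ.filter (fun l : Fin n => 1 ≤ (l : ℕ) ∧ (l : ℕ) < k),
        Complex.normSq (x l) : ℝ) : ℂ) ≤ star x ⬝ᵥ (fsBlock n k z).mulVec x := by
  set s := Finset.univ.filter (fun l : Fin n => 1 ≤ (l : ℕ) ∧ (l : ℕ) < k) with hs
  set S : ℝ := 1 + ∑ l ∈ s, Complex.normSq (z l) with hS
  have hSpos : 0 < S :=
    add_pos_of_pos_of_nonneg one_pos (Finset.sum_nonneg fun _ _ => Complex.normSq_nonneg _)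
  have hform : star x ⬝ᵥ (fsBlock n k z).mulVec x =
      (((S * ∑ l ∈ s, Complex.normSq (x l) - Complex.normSq (∑ l ∈ s, z l * x l)) / S ^ 2 : ℝ)
        : ℂ) := by
    have h1 : star x ⬝ᵥ (fsBlock n k z).mulVec x =
        ∑ i ∈ s, ∑ j ∈ s, (starRingEnd ℂ) (x i) *
          (((S : ℂ) * (if i = j then 1 else 0) - (starRingEnd ℂ) (z i) * z j) / (S : ℂ) ^ 2
            * x j) := by
      simp only [dotProduct, Matrix.mulVec, fsBlock, Matrix.of_apply, Finset.mul_sum, Pi.star_apply,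
        hs, Finset.sum_filter, ← starRingEnd_apply]
      refine Finset.sum_congr rfl fun i _ => ?_
      by_cases hi : 1 ≤ (i : ℕ) ∧ (i : ℕ) < k
      · rw [if_pos hi]
        refine Finset.sum_congr rfl fun j _ => ?_
        by_cases hj : 1 ≤ (j : ℕ) ∧ (j : ℕ) < k
        · rw [if_pos ⟨hi, hj⟩, if_pos hj, hS, hs, Finset.sum_filter]
        · rw [if_neg fun h => hj h.2, if_neg hj]; simp
      · rw [if_neg hi]
        refine Finset.sum_eq_zero fun j _ => ?_
        rw [if_neg fun h => hi h.1]; simp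
    have h2 (i j : Fin n) : (starRingEnd ℂ) (x i) *
          (((S : ℂ) * (if i = j then 1 else 0) - (starRingEnd ℂ) (z i) * z j) / (S : ℂ) ^ 2
            * x j) =
        ((if i = j then (S : ℂ) * ((starRingEnd ℂ) (x i) * x j) else 0) -
          (starRingEnd ℂ) (z i * x i) * (z j * x j)) / (S : ℂ) ^ 2 := by
      split_ifs <;> simp only [map_mul] <;> ring
    rw [h1]
    simp only [h2, ← Finset.sum_div, Finset.sum_sub_distrib, ← Finset.mul_sum, ← Finset.sum_mul]
    push_cast
    rw [Complex.normSq_eq_conj_mul_self, map_sum, Finset.mul_sum s _ (S : ℂ)]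
    congr 2
    refine Finset.sum_congr rfl fun i hi => ?_
    rw [Finset.sum_ite_eq s i, if_pos hi, Complex.normSq_eq_conj_mul_self]
  have hcs : Complex.normSq (∑ l ∈ s, z l * x l) ≤
      (∑ l ∈ s, Complex.normSq (z l)) * ∑ l ∈ s, Complex.normSq (x l) := by
    simp only [Complex.normSq_eq_norm_sq]
    calc ‖∑ l ∈ s, z l * x l‖ ^ 2 ≤ (∑ l ∈ s, ‖z l‖ * ‖x l‖) ^ 2 := by
          gcongr
          simpa only [norm_mul] using norm_sum_le s fun l => z l * x l
      _ ≤ _ := Finset.sum_mul_sq_le_sq_mul_sq s _ _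
  refine ⟨1 / S ^ 2, by positivity, ?_⟩
  rw [hform, Complex.real_le_real, one_div_mul_eq_div]
  gcongr
  rw [hS]
  linarith

/-- Lemma 1.3 of the paper (local computation, with `ω_Y` Euclidean): for every `ε > 0` and
every `z ∈ ℂⁿ`, the Hermitian matrix `G(z) = H(z) + ε·F(z)` — the coefficient matrix of
`π*ω_{ℂⁿ} + ε·i∂∂̄ log σ_X` — is positive definite. -/
theorem stmt9 (n k : ℕ) [NeZero n] (hk1 : 1 ≤ k) (hkn : k ≤ n)
    (ε : ℝ) (hε : 0 < ε) (z : Fin n → ℂ) :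
    (blowdownGram n k z + ε • fsBlock n k z).PosDef := by
  have hH : (blowdownGram n k z).PosSemidef := by
    rw [blowdownGram_eq]
    exact Matrix.posSemidef_self_mul_conjTranspose _
  refine Matrix.PosDef.of_dotProduct_mulVec_pos
    (hH.isHermitian.add ((fsBlock_isHermitian n k z).smul (IsSelfAdjoint.all ε))) fun x hx => ?_
  rw [Matrix.add_mulVec, dotProduct_add, Matrix.smul_mulVec, dotProduct_smul]
  have hHx := hH.dotProduct_mulVec_nonneg x
  obtain ⟨c, hc, hle⟩ := le_fsBlock_form n k z x
  set s := Finset.univ.filter (fun l : Fin n => 1 ≤ (l : ℕ) ∧ (l : ℕ) < k) with hs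
  rcases (Finset.sum_nonneg fun l (_ : l ∈ s) => Complex.normSq_nonneg (x l)).eq_or_lt with h0 | h0
  · rw [← h0, mul_zero, Complex.ofReal_zero] at hle
    refine add_pos_of_pos_of_nonneg (hHx.lt_of_ne fun h => hx ?_) (smul_nonneg hε.le hle)
    have hx' (l : Fin n) (h1 : 1 ≤ (l : ℕ)) (h2 : (l : ℕ) < k) : x l = 0 :=
      Complex.normSq_eq_zero.1 <| (Finset.sum_eq_zero_iff_of_nonneg
        fun l _ => Complex.normSq_nonneg (x l)).1 h0.symm l (by simp [hs, h1, h2])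
    rw [blowdownGram_eq, ← Matrix.mulVec_mulVec, Matrix.dotProduct_mulVec,
      ← Matrix.conjTranspose_conjTranspose (blowdownJac n k z).transpose,
      ← Matrix.star_mulVec, Matrix.conjTranspose_conjTranspose, eq_comm,
      dotProduct_star_self_eq_zero] at h
    have hJ (a : Fin n) : ∑ i, (starRingEnd ℂ) (blowdownJac n k z a i) * x i = 0 := congrFun h a
    simp only [blowdownJac_apply] at hJ
    ext l
    rcases Nat.eq_zero_or_pos (l : ℕ) with hl | hl
    · have := hJ l
      obtain rfl : l = 0 := Fin.ext (by simpa using hl)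
      simpa [Pi.single_apply] using this
    · by_cases hlk : (l : ℕ) < k
      · exact hx' l hl hlk
      · have := hJ l
        simpa [hl.ne', hlk, Pi.single_apply] using this
  · exact add_pos_of_nonneg_of_pos hHx (smul_pos hε (lt_of_lt_of_le
      (Complex.zero_lt_real.2 (mul_pos hc h0)) hle))
end
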